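/- Simulation of non-quantified rewrite steps by existential extension: Let ρ be a left-linear constrained rewrite rule. If ⟨X, s, φ⟩ →_ρ ⟨Y, t, φ⟩ is a rewrite step on non-quantified constrained terms, then there exists an existentially constrained term that is reached from ext(⟨X, s, φ⟩) by a most general rewrite step with ρ and that subsumes ext(⟨Y, t, φ⟩); i.e. ext(⟨X, s, φ⟩) → · ⊒ ext(⟨Y, t, φ⟩). -/

import Mathlib

namespace LCTRS

open scoped Classical

noncomputable section

/-- First-order terms over function symbols `F` and variables `V`. -/
inductive Term (F V : Type) : Type where
  | var : V → Term F V
  | app : F → List (Term F V) → Term F V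

variable {F V D : Type}

/-- Occurrence of a variable in a term. -/
inductive Term.VarIn (x : V) : Term F V → Prop where
  | var : Term.VarIn x (Term.var x)
  | app {f : F} {ts : List (Term F V)} {t : Term F V} :
      t ∈ ts → Term.VarIn x t → Term.VarIn x (Term.app f ts)

/-- The set of variables occurring in a term. -/
def Term.vars (t : Term F V) : Set V := {x | Term.VarIn x t}

/-- Application of a substitution to a term. -/
def Term.subst (t : Term F V) (σ : V → Term F V) : Term F V :=
  match t with
  | .var x => σ x
  | .app f ts => .app f (ts.attach.map (fun u => u.1.subst σ))
decreasing_by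
  have := List.sizeOf_lt_of_mem u.2
  simp only [Term.app.sizeOf_spec] at *
  omega

/-- The domain of a substitution. -/
def substDom (σ : V → Term F V) : Set V := {x | σ x ≠ Term.var x}

/-- Positions in a term. -/
abbrev Pos := List Nat

/-- `SubtermAt s p u`: the subterm of `s` at position `p` exists and equals `u`. -/
inductive SubtermAt : Term F V → Pos → Term F V → Prop where
  | refl (t : Term F V) : SubtermAt t [] t
  | app {f : F} {ts : List (Term F V)} {i : Nat} {t u : Term F V} {p : Pos} :
      ts[i]? = some t → SubtermAt t p u → SubtermAt (Term.app f ts) (i :: p) u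

/-- `ReplaceAt s p u t`: replacing the subterm of `s` at position `p` by `u` yields `t`. -/
inductive ReplaceAt : Term F V → Pos → Term F V → Term F V → Prop where
  | here (t u : Term F V) : ReplaceAt t [] u u
  | app {f : F} {ts : List (Term F V)} {i : Nat} {p : Pos} {u t t' : Term F V} :
      ts[i]? = some t → ReplaceAt t p u t' →
      ReplaceAt (Term.app f ts) (i :: p) u (Term.app f (ts.set i t'))

/-- Replacement at a list of pairwise parallel positions (performed sequentially). -/
inductive ReplaceList : Term F V → List Pos → List (Term F V) → Term F V → Prop where
  | nil (t : Term F V) : ReplaceList t [] [] t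
  | cons {t t₁ t₂ : Term F V} {p : Pos} {ps : List Pos} {u : Term F V} {us : List (Term F V)} :
      ReplaceAt t p u t₁ → ReplaceList t₁ ps us t₂ → ReplaceList t (p :: ps) (u :: us) t₂

/-- A term is linear if each variable occurs at most once in it. -/
def Term.Linear (t : Term F V) : Prop :=
  ∀ (x : V) (p q : Pos), SubtermAt t p (Term.var x) → SubtermAt t q (Term.var x) → p = q

/-- A term is `X`-linear if each variable of `X` occurs at most once in it. -/
def Term.LinearOn (t : Term F V) (X : Set V) : Prop :=
  ∀ x ∈ X, ∀ (p q : Pos), SubtermAt t p (Term.var x) → SubtermAt t q (Term.var x) → p = q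

/-- A model over the (theory part of the) signature: an interpretation of the function
symbols over a domain `D`, a designated truth value, a set `Val` of value constants such
that every domain element is denoted by some value, and designated conjunction, equality
and truth symbols interpreted as expected. -/
structure Model (F V D : Type) where
  interp : F → List D → D
  tval : D
  Val : Set F
  andSym : F
  eqSym : F
  trueSym : F
  val_const : ∀ v ∈ Val, ∀ ds : List D, interp v ds = interp v []
  val_surj : ∀ d : D, ∃ v ∈ Val, interp v [] = d
  and_spec : ∀ a b : D, (interp andSym [a, b] = tval ↔ (a = tval ∧ b = tval))
  eq_spec : ∀ a b : D, (interp eqSym [a, b] = tval ↔ a = b)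
  true_spec : interp trueSym [] = tval

/-- Evaluation of a term in a model under a valuation. -/
def Model.eval (M : Model F V D) (ξ : V → D) (t : Term F V) : D :=
  match t with
  | .var x => ξ x
  | .app f ts => M.interp f (ts.attach.map (fun u => M.eval ξ u.1))
decreasing_by
  have := List.sizeOf_lt_of_mem u.2
  simp only [Term.app.sizeOf_spec] at *
  omega

/-- A constraint holds in `M` under the valuation `ξ`. -/
def Model.holds (M : Model F V D) (ξ : V → D) (φ : Term F V) : Prop := M.eval ξ φ = M.tval

/-- `⊨_M φ`: the constraint `φ` holds under every valuation. -/
def Model.validC (M : Model F V D) (φ : Term F V) : Prop := ∀ ξ : V → D, M.holds ξ φ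

/-- `t` is a value (a constant from `Val`). -/
def Model.IsValueTerm (M : Model F V D) (t : Term F V) : Prop := ∃ v ∈ M.Val, t = Term.app v []

/-- The root symbol of `t` is a value symbol. -/
def Model.IsValueSym (M : Model F V D) (t : Term F V) : Prop :=
  ∃ v ∈ M.Val, ∃ ts : List (Term F V), t = Term.app v ts

/-- No value occurs in `t`. -/
def Term.ValueFree (t : Term F V) (M : Model F V D) : Prop :=
  ∀ (p : Pos) (u : Term F V), SubtermAt t p u → ¬ M.IsValueSym u

/-- The conjunction `φ ∧ ψ` as a constraint. -/
def Model.conj (M : Model F V D) (φ ψ : Term F V) : Term F V := Term.app M.andSym [φ, ψ]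

/-- The equation `s = t` as a constraint. -/
def Model.eqc (M : Model F V D) (s t : Term F V) : Term F V := Term.app M.eqSym [s, t]

/-- The constraint `true`. -/
def Model.trueC (M : Model F V D) : Term F V := Term.app M.trueSym []

/-- `φ ∧ ψ₁ ∧ ⋯ ∧ ψₙ`. -/
def Model.conjFrom (M : Model F V D) (φ : Term F V) (l : List (Term F V)) : Term F V :=
  l.foldl M.conj φ

/-- `ψ₁ ∧ ⋯ ∧ ψₙ`. -/
def Model.bigConj (M : Model F V D) (l : List (Term F V)) : Term F V :=
  l.foldl M.conj M.trueC

/-- An existential constraint `⟨∃x⃗. φ⟩`: a set of (bound) variables together with a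
constraint. -/
structure EC (F V : Type) where
  bvars : Set V
  constr : Term F V

/-- Well-formedness of an existential constraint: `{x⃗} ⊆ Var(φ)`. -/
def EC.WF (c : EC F V) : Prop := c.bvars ⊆ c.constr.vars

/-- Free variables of an existential constraint. -/
def EC.fvars (c : EC F V) : Set V := c.constr.vars \ c.bvars

/-- `⟨∃x⃗. φ⟩` holds under valuation `ξ`: `φκ` holds under `ξ` for some substitution `κ`
mapping `x⃗` into `Val` (and the identity elsewhere). -/
def EC.holdsUnder (c : EC F V) (M : Model F V D) (ξ : V → D) : Prop :=
  ∃ κ : V → Term F V, (∀ x ∈ c.bvars, M.IsValueTerm (κ x)) ∧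
    (∀ x ∉ c.bvars, κ x = Term.var x) ∧ M.holds ξ (c.constr.subst κ)

/-- `⊨_M ⟨∃x⃗. φ⟩`. -/
def EC.validM (c : EC F V) (M : Model F V D) : Prop := ∀ ξ : V → D, c.holdsUnder M ξ

/-- Satisfiability of an existential constraint. -/
def EC.satisfiable (c : EC F V) (M : Model F V D) : Prop := ∃ ξ : V → D, c.holdsUnder M ξ

/-- Application of a substitution to an existential constraint acts on the free
variables only. -/
def EC.subst (c : EC F V) (σ : V → Term F V) : EC F V :=
  ⟨c.bvars, c.constr.subst (fun x => if x ∈ c.bvars then Term.var x else σ x)⟩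

/-- `⊨_M ⟨∃x⃗.φ⟩ ⇔ ⟨∃y⃗.ψ⟩`. -/
def ECIffM (M : Model F V D) (c c' : EC F V) : Prop :=
  ∀ ξ : V → D, c.holdsUnder M ξ ↔ c'.holdsUnder M ξ

/-- `σ ⊨_M ⟨∃x⃗.φ⟩`: `σ` maps the free variables into values and `(⟨∃x⃗.φ⟩)σ` is valid. -/
def SubstRespectsEC (M : Model F V D) (σ : V → Term F V) (c : EC F V) : Prop :=
  (∀ x ∈ c.fvars, M.IsValueTerm (σ x)) ∧ (c.subst σ).validM M

/-- `σ` respects the plain constraint `φ`. -/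
def SubstRespects (M : Model F V D) (σ : V → Term F V) (φ : Term F V) : Prop :=
  (∀ x ∈ φ.vars, M.IsValueTerm (σ x)) ∧ M.validC (φ.subst σ)

/-- An existentially constrained term `⟨X, s, ∃x⃗.φ⟩`. -/
structure ECTerm (F V : Type) where
  lvars : Set V
  term : Term F V
  ec : EC F V

/-- Well-formedness: `{x⃗} ⊆ Var(φ)`, `FVar(⟨∃x⃗.φ⟩) ⊆ X ⊆ Var(s)` and `{x⃗} ∩ Var(s) = ∅`. -/
def ECTerm.WF (T : ECTerm F V) : Prop :=
  T.ec.WF ∧ T.ec.fvars ⊆ T.lvars ∧ T.lvars ⊆ T.term.vars ∧ ∀ x ∈ T.ec.bvars, x ∉ T.term.vars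

/-- Satisfiability of an existentially constrained term. -/
def ECTerm.satisfiable (T : ECTerm F V) (M : Model F V D) : Prop := T.ec.satisfiable M

/-- `T` is subsumed by `T'`. -/
def SubsumedBy (M : Model F V D) (T T' : ECTerm F V) : Prop :=
  ∀ σ : V → Term F V, (∀ x ∈ T.lvars, M.IsValueTerm (σ x)) → SubstRespectsEC M σ T.ec →
    ∃ γ : V → Term F V, (∀ y ∈ T'.lvars, M.IsValueTerm (γ y)) ∧ SubstRespectsEC M γ T'.ec ∧
      T.term.subst σ = T'.term.subst γ

/-- Equivalence of existentially constrained terms. -/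
def ECEquiv (M : Model F V D) (T T' : ECTerm F V) : Prop :=
  SubsumedBy M T T' ∧ SubsumedBy M T' T

/-- An existentially constrained term is pattern-general if its term is linear in its
logical variables and contains no value. -/
def ECTerm.PatternGeneral (T : ECTerm F V) (M : Model F V D) : Prop :=
  T.term.LinearOn T.lvars ∧ T.term.ValueFree M

/-- A constrained rewrite rule `Π Z. ℓ → r [π]`. -/
structure Rule (F V : Type) where
  Z : Set V
  lhs : Term F V
  rhs : Term F V
  constr : Term F V

/-- `Var(ρ)`. -/
def Rule.vars (ρ : Rule F V) : Set V := ρ.lhs.vars ∪ ρ.rhs.vars ∪ ρ.constr.vars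

/-- `ExVar(ρ) = Var(r) \ Var(ℓ)`. -/
def Rule.exVars (ρ : Rule F V) : Set V := ρ.rhs.vars \ ρ.lhs.vars

/-- Well-formedness of a rule: `(Var(r) \ Var(ℓ)) ∪ Var(π) ⊆ Z ⊆ Var(ℓ,r,π)`. -/
def Rule.WF (ρ : Rule F V) : Prop :=
  (ρ.rhs.vars \ ρ.lhs.vars) ∪ ρ.constr.vars ⊆ ρ.Z ∧ ρ.Z ⊆ ρ.vars

/-- Left-linearity. -/
def Rule.LeftLinear (ρ : Rule F V) : Prop := ρ.lhs.Linear

/-- A rule is left-value-free if it is left-linear and no value occurs in its lhs. -/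
def Rule.LeftValueFree (ρ : Rule F V) (M : Model F V D) : Prop :=
  ρ.LeftLinear ∧ ρ.lhs.ValueFree M

/-- `ρ'` is a renamed variant of `ρ`. -/
def Rule.IsVariantOf (ρ' ρ : Rule F V) : Prop :=
  ∃ δ : V → V, Function.Bijective δ ∧
    ρ'.Z = δ '' ρ.Z ∧ ρ'.lhs = ρ.lhs.subst (fun x => Term.var (δ x)) ∧
    ρ'.rhs = ρ.rhs.subst (fun x => Term.var (δ x)) ∧
    ρ'.constr = ρ.constr.subst (fun x => Term.var (δ x))

/-- `⟨X,s,∃x⃗.φ⟩` has a `ρ`-redex at position `p` using substitution `γ`. -/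
structure RedexAt (M : Model F V D) (ρ : Rule F V) (T : ECTerm F V)
    (p : Pos) (γ : V → Term F V) : Prop where
  dom : substDom γ = ρ.lhs.vars
  matchAt : SubtermAt T.term p (ρ.lhs.subst γ)
  lvar : ∀ x ∈ ρ.lhs.vars ∩ ρ.Z, M.IsValueTerm (γ x) ∨ ∃ y ∈ T.lvars, γ x = Term.var y
  implied : ∀ ξ : V → D, T.ec.holdsUnder M ξ →
    EC.holdsUnder ⟨ρ.constr.vars \ ρ.lhs.vars, ρ.constr.subst γ⟩ M ξ

/-- A most general rewrite step at position `p` using substitution `γ`. -/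
structure MGStepData (M : Model F V D) (ρ : Rule F V) (T T' : ECTerm F V)
    (p : Pos) (γ : V → Term F V) : Prop where
  redex : RedexAt M ρ T p γ
  target : ReplaceAt T.term p (ρ.rhs.subst γ) T'.term
  cstr : T'.ec.constr = M.conj T.ec.constr (ρ.constr.subst γ)
  bnd : T'.ec.bvars = T'.ec.constr.vars \ T'.term.vars
  lv : T'.lvars = ρ.exVars ∪ (T.lvars ∩ T'.term.vars)

/-- A most general rewrite step at position `p`. -/
def MGStepAt (M : Model F V D) (ρ : Rule F V) (p : Pos) (T T' : ECTerm F V) : Prop :=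
  ∃ γ : V → Term F V, MGStepData M ρ T T' p γ

/-- A most general rewrite step. -/
def MGStep (M : Model F V D) (ρ : Rule F V) (T T' : ECTerm F V) : Prop :=
  ∃ (p : Pos) (γ : V → Term F V), MGStepData M ρ T T' p γ

/-- A non-quantified constrained term `⟨X, s, φ⟩`. -/
structure NQTerm (F V : Type) where
  lvars : Set V
  term : Term F V
  constr : Term F V

/-- Well-formedness: `Var(φ) ⊆ X ⊆ Var(φ, s)`. -/
def NQTerm.WF (T : NQTerm F V) : Prop :=
  T.constr.vars ⊆ T.lvars ∧ T.lvars ⊆ T.constr.vars ∪ T.term.vars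

/-- Satisfiability of a non-quantified constrained term. -/
def NQTerm.satisfiable (T : NQTerm F V) (M : Model F V D) : Prop :=
  ∃ ξ : V → D, M.holds ξ T.constr

/-- Subsumption of non-quantified constrained terms. -/
def NQSubsumedBy (M : Model F V D) (T T' : NQTerm F V) : Prop :=
  ∀ σ : V → Term F V, (∀ x ∈ T.lvars, M.IsValueTerm (σ x)) → SubstRespects M σ T.constr →
    ∃ γ : V → Term F V, (∀ y ∈ T'.lvars, M.IsValueTerm (γ y)) ∧ SubstRespects M γ T'.constr ∧
      T.term.subst σ = T'.term.subst γ

/-- Equivalence of non-quantified constrained terms. -/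
def NQEquiv (M : Model F V D) (T T' : NQTerm F V) : Prop :=
  NQSubsumedBy M T T' ∧ NQSubsumedBy M T' T

/-- A rewrite step on non-quantified constrained terms at position `p` using `σ`. -/
structure NQStepData (M : Model F V D) (ρ : Rule F V) (T T' : NQTerm F V)
    (p : Pos) (σ : V → Term F V) : Prop where
  fresh : Disjoint ρ.vars (T.lvars ∪ T.term.vars ∪ T.constr.vars)
  funpos : ∃ (f : F) (ts : List (Term F V)), SubtermAt T.term p (Term.app f ts)
  dom : substDom σ = ρ.vars
  matchAt : SubtermAt T.term p (ρ.lhs.subst σ)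
  zval : ∀ x ∈ ρ.Z, M.IsValueTerm (σ x) ∨ ∃ y ∈ T.lvars, σ x = Term.var y
  implied : ∀ ξ : V → D, M.holds ξ T.constr → M.holds ξ (ρ.constr.subst σ)
  target : ReplaceAt T.term p (ρ.rhs.subst σ) T'.term
  cstr : T'.constr = T.constr
  lv : T'.lvars = T.lvars ∩ (T'.term.vars ∪ T.constr.vars)

/-- A rewrite step on non-quantified constrained terms. -/
def NQStep (M : Model F V D) (ρ : Rule F V) (T T' : NQTerm F V) : Prop :=
  ∃ (p : Pos) (σ : V → Term F V), NQStepData M ρ T T' p σ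

/-- The existential removing translation `rmv`. -/
def rmv (T : ECTerm F V) : NQTerm F V := ⟨T.lvars ∪ T.ec.bvars, T.term, T.ec.constr⟩

/-- The existential extension translation `ext`. -/
def ext (T : NQTerm F V) : ECTerm F V :=
  ⟨T.lvars \ (T.constr.vars \ T.term.vars), T.term, ⟨T.constr.vars \ T.term.vars, T.constr⟩⟩

/-- Positions of `s` whose symbol is a variable of `X` or a value. -/
def PosXVal (M : Model F V D) (X : Set V) (s : Term F V) : Set Pos :=
  {p | ∃ u : Term F V, SubtermAt s p u ∧ ((∃ x ∈ X, u = Term.var x) ∨ M.IsValueSym u)}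

/-- `s'` is the bullet translation `s^{•X}` of `s`, obtained by replacing the subterms at
the positions `ps` (which enumerate `Pos_{X∪Val}(s)`) by the pairwise distinct fresh
variables `xs`. -/
structure BulletData (M : Model F V D) (X avoid : Set V) (s : Term F V)
    (ps : List Pos) (xs : List V) (s' : Term F V) : Prop where
  nodup_ps : ps.Nodup
  cover : ∀ p : Pos, p ∈ ps ↔ p ∈ PosXVal M X s
  nodup_xs : xs.Nodup
  len : xs.length = ps.length
  fresh : ∀ x ∈ xs, x ∉ avoid
  repl : ReplaceList s ps (xs.map Term.var) s'

/-- `T'` is the pattern-general translation `PG(T)` of `T` (with fresh variables chosen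
outside `avoid`). -/
def IsPG (M : Model F V D) (avoid : Set V) (T T' : ECTerm F V) : Prop :=
  ∃ (ps : List Pos) (xs : List V) (us : List (Term F V)),
    BulletData M T.lvars avoid T.term ps xs T'.term ∧
    List.Forall₂ (fun p u => SubtermAt T.term p u) ps us ∧
    T'.lvars = {x | x ∈ xs} ∧
    T'.ec.bvars = T.ec.bvars ∪ T.lvars ∧
    T'.ec.constr = M.conjFrom T.ec.constr (List.zipWith M.eqc us (xs.map Term.var))

/-- `ρh` is the left-value-free transformation `lvf(ρ)` of `ρ`. -/
def IsLVF (M : Model F V D) (ρ ρh : Rule F V) : Prop :=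
  ∃ (ps : List Pos) (xs : List V) (vs : List (Term F V)),
    ps.Nodup ∧ xs.Nodup ∧ xs.length = ps.length ∧
    (∀ p : Pos, p ∈ ps ↔ p ∈ PosXVal M (∅ : Set V) ρ.lhs) ∧
    List.Forall₂ (fun p v => SubtermAt ρ.lhs p v ∧ M.IsValueTerm v) ps vs ∧
    (∀ x ∈ xs, x ∉ ρ.vars) ∧
    ρh.Z = ρ.Z ∪ {x | x ∈ xs} ∧
    ReplaceList ρ.lhs ps (xs.map Term.var) ρh.lhs ∧
    ρh.rhs = ρ.rhs ∧
    ρh.constr = M.conjFrom ρ.constr (List.zipWith M.eqc (xs.map Term.var) vs)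

/-- A most general rewrite step with a fresh variant of some rule of the LCTRS `R`. -/
def StepR (M : Model F V D) (R : Set (Rule F V)) (T T' : ECTerm F V) : Prop :=
  ∃ ρ ∈ R, ∃ ρ' : Rule F V, ρ'.IsVariantOf ρ ∧
    Disjoint ρ'.vars (T.term.vars ∪ T.ec.constr.vars) ∧ MGStep M ρ' T T'

/-- One `∼ · →_R` step (on well-formed, satisfiable existentially constrained terms). -/
def SimStep (M : Model F V D) (R : Set (Rule F V)) (T T' : ECTerm F V) : Prop :=
  ∃ U : ECTerm F V, U.WF ∧ U.satisfiable M ∧ ECEquiv M T U ∧ StepR M R U T'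

/-- `n`-fold composition of a relation. -/
def RelPow {α : Type _} (r : α → α → Prop) : ℕ → α → α → Prop
  | 0 => fun a b => a = b
  | n + 1 => fun a c => ∃ b, r a b ∧ RelPow r n b c


lemma Term.mem_vars_var {x y : V} : x ∈ (Term.var y : Term F V).vars ↔ x = y := by
  constructor
  · rintro ⟨⟩; rfl
  · rintro rfl; exact .var

lemma Term.mem_vars_app {x : V} {f : F} {ts : List (Term F V)} :
    x ∈ (Term.app f ts).vars ↔ ∃ t ∈ ts, x ∈ t.vars := by
  constructor
  · rintro (_ | ⟨ht, hx⟩); exact ⟨_, ht, hx⟩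
  · rintro ⟨t, ht, hx⟩; exact .app ht hx

lemma Term.subst_var (x : V) (σ : V → Term F V) : (Term.var x).subst σ = σ x := by
  rw [Term.subst]

lemma Term.subst_app (f : F) (ts : List (Term F V)) (σ : V → Term F V) :
    (Term.app f ts).subst σ = Term.app f (ts.map (fun u => u.subst σ)) := by
  rw [Term.subst]
  simp

lemma Model.eval_var (M : Model F V D) (ξ : V → D) (x : V) : M.eval ξ (Term.var x) = ξ x := by
  rw [Model.eval]

lemma Model.eval_app (M : Model F V D) (ξ : V → D) (f : F) (ts : List (Term F V)) :
    M.eval ξ (Term.app f ts) = M.interp f (ts.map (M.eval ξ)) := by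
  rw [Model.eval]
  simp

/-- Structural induction on terms, with the hypothesis for every argument of an application. -/
lemma Term.ind {P : Term F V → Prop} (hvar : ∀ x, P (.var x))
    (happ : ∀ f ts, (∀ t ∈ ts, P t) → P (.app f ts)) : ∀ t, P t
  | .var x => hvar x
  | .app f ts => happ f ts fun t _ => Term.ind hvar happ t

lemma Term.mem_vars_subst {t : Term F V} {σ : V → Term F V} {x : V} :
    x ∈ (t.subst σ).vars ↔ ∃ y ∈ t.vars, x ∈ (σ y).vars := by
  induction t using Term.ind with
  | hvar y => simp [Term.subst_var, Term.mem_vars_var]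
  | happ f ts ih =>
    simp only [Term.subst_app, Term.mem_vars_app, List.mem_map]
    constructor
    · rintro ⟨_, ⟨u, hu, rfl⟩, hx⟩
      obtain ⟨y, hy, hxy⟩ := (ih u hu).1 hx
      exact ⟨y, ⟨u, hu, hy⟩, hxy⟩
    · rintro ⟨y, ⟨u, hu, hy⟩, hxy⟩
      exact ⟨_, ⟨u, hu, rfl⟩, (ih u hu).2 ⟨y, hy, hxy⟩⟩

lemma Term.subst_congr {t : Term F V} {σ τ : V → Term F V} (h : ∀ x ∈ t.vars, σ x = τ x) :
    t.subst σ = t.subst τ := by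
  induction t using Term.ind with
  | hvar y => simpa [Term.subst_var] using h y .var
  | happ f ts ih =>
    simp only [Term.subst_app, Term.app.injEq, true_and]
    exact List.map_congr_left fun u hu => ih u hu fun x hx => h x (Term.mem_vars_app.2 ⟨u, hu, hx⟩)

lemma Term.subst_subst (t : Term F V) (σ τ : V → Term F V) :
    (t.subst σ).subst τ = t.subst fun x => (σ x).subst τ := by
  induction t using Term.ind with
  | hvar y => simp [Term.subst_var]
  | happ f ts ih => simpa [Term.subst_app] using ih

lemma Model.eval_congr (M : Model F V D) {t : Term F V} {ξ ζ : V → D}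
    (h : ∀ x ∈ t.vars, ξ x = ζ x) : M.eval ξ t = M.eval ζ t := by
  induction t using Term.ind with
  | hvar y => simpa [Model.eval_var] using h y .var
  | happ f ts ih =>
    simp only [Model.eval_app]
    congr 1
    exact List.map_congr_left fun u hu => ih u hu fun x hx => h x (Term.mem_vars_app.2 ⟨u, hu, hx⟩)

lemma Model.eval_subst (M : Model F V D) (ξ : V → D) (t : Term F V) (σ : V → Term F V) :
    M.eval ξ (t.subst σ) = M.eval (fun x => M.eval ξ (σ x)) t := by
  induction t using Term.ind with
  | hvar y => simp [Term.subst_var, Model.eval_var]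
  | happ f ts ih =>
    simp only [Term.subst_app, Model.eval_app, List.map_map]
    congr 1
    exact List.map_congr_left ih

lemma Model.holds_conj (M : Model F V D) (ξ : V → D) (φ ψ : Term F V) :
    M.holds ξ (M.conj φ ψ) ↔ M.holds ξ φ ∧ M.holds ξ ψ := by
  simp [Model.holds, Model.conj, Model.eval_app, M.and_spec]

lemma Model.mem_vars_conj (M : Model F V D) {φ ψ : Term F V} {x : V} :
    x ∈ (M.conj φ ψ).vars ↔ x ∈ φ.vars ∨ x ∈ ψ.vars := by
  simp [Model.conj, Term.mem_vars_app]

lemma Model.IsValueTerm.subst_eq {M : Model F V D} {t : Term F V} (h : M.IsValueTerm t)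
    (σ : V → Term F V) : t.subst σ = t := by
  obtain ⟨v, -, rfl⟩ := h
  simp [Term.subst_app]

lemma Model.IsValueTerm.eval_eq {M : Model F V D} {t : Term F V} (h : M.IsValueTerm t)
    (ξ ζ : V → D) : M.eval ξ t = M.eval ζ t := by
  obtain ⟨v, -, rfl⟩ := h
  simp [Model.eval_app]

lemma Model.IsValueTerm.not_mem_vars {M : Model F V D} {t : Term F V} (h : M.IsValueTerm t)
    (x : V) : x ∉ t.vars := by
  obtain ⟨v, -, rfl⟩ := h
  simp [Term.mem_vars_app]

/-- A value term denoting a given element of the domain. -/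
def Model.valueOf (M : Model F V D) (d : D) : Term F V := Term.app (M.val_surj d).choose []

lemma Model.isValueTerm_valueOf (M : Model F V D) (d : D) : M.IsValueTerm (M.valueOf d) :=
  ⟨_, (M.val_surj d).choose_spec.1, rfl⟩

lemma Model.eval_valueOf (M : Model F V D) (ξ : V → D) (d : D) : M.eval ξ (M.valueOf d) = d := by
  simpa [Model.valueOf, Model.eval_app] using (M.val_surj d).choose_spec.2

lemma EC.holdsUnder_iff (c : EC F V) (M : Model F V D) (ξ : V → D) :
    c.holdsUnder M ξ ↔ ∃ ζ : V → D, (∀ x ∉ c.bvars, ζ x = ξ x) ∧ M.holds ζ c.constr := by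
  constructor
  · rintro ⟨κ, -, hκ, h⟩
    refine ⟨fun x => M.eval ξ (κ x), fun x hx => ?_, ?_⟩
    · simp [hκ x hx, Model.eval_var]
    · simpa [Model.holds, Model.eval_subst] using h
  · rintro ⟨ζ, hζ, h⟩
    refine ⟨fun x => if x ∈ c.bvars then M.valueOf (ζ x) else .var x, fun x hx => ?_,
      fun x hx => by simp [hx], ?_⟩
    · simpa [hx] using M.isValueTerm_valueOf _
    · rw [Model.holds, Model.eval_subst, ← h]
      refine M.eval_congr fun x _ => ?_
      by_cases hx : x ∈ c.bvars
      · simp [hx, Model.eval_valueOf]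
      · simp [hx, Model.eval_var, hζ x hx]

/-- For a substitution with values on the free variables, validity of the instance means
satisfaction by a valuation that agrees with the substitution on the free variables. -/
lemma EC.holdsUnder_subst_iff (c : EC F V) (M : Model F V D) {σ : V → Term F V}
    (hσ : ∀ x ∈ c.fvars, M.IsValueTerm (σ x)) (ξ : V → D) :
    (c.subst σ).holdsUnder M ξ ↔
      ∃ ζ : V → D, (∀ x ∈ c.fvars, ζ x = M.eval ξ (σ x)) ∧ M.holds ζ c.constr := by
  rw [EC.holdsUnder_iff]
  simp only [EC.subst, Model.holds, Model.eval_subst]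
  constructor
  · rintro ⟨ζ, -, h⟩
    refine ⟨_, fun x hx => ?_, h⟩
    rw [if_neg hx.2]
    exact (hσ x hx).eval_eq _ _
  · rintro ⟨ζ, hζ, h⟩
    refine ⟨fun x => if x ∈ c.bvars then ζ x else ξ x, fun x hx => by simp [hx], ?_⟩
    rw [← h]
    refine M.eval_congr fun x hx => ?_
    by_cases hb : x ∈ c.bvars
    · simp [hb, Model.eval_var]
    · rw [if_neg hb, hζ x ⟨hx, hb⟩]
      exact (hσ x ⟨hx, hb⟩).eval_eq _ _

lemma SubtermAt.vars_subset {s u : Term F V} {p : Pos} (h : SubtermAt s p u) :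
    u.vars ⊆ s.vars := by
  induction h with
  | refl t => exact subset_rfl
  | app hi _ ih => exact fun x hx => Term.mem_vars_app.2 ⟨_, List.mem_of_getElem? hi, ih hx⟩

lemma ReplaceAt.vars_subset {s u t : Term F V} {p : Pos} (h : ReplaceAt s p u t) :
    u.vars ⊆ t.vars := by
  induction h with
  | here t u => exact subset_rfl
  | app hi _ ih =>
    refine fun x hx => Term.mem_vars_app.2 ⟨_, ?_, ih hx⟩
    exact List.mem_set (List.getElem?_eq_some_iff.1 hi).1 _

/-- Replacing at the same position by another term: the context variables are shared, and
instances of the results agree as soon as the contexts and the replaced terms agree. -/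
lemma ReplaceAt.exchange {s u t' : Term F V} {p : Pos} (h : ReplaceAt s p u t')
    (v : Term F V) :
    ∃ t, ReplaceAt s p v t ∧ (∀ x ∈ t.vars, x ∈ v.vars ∨ (x ∈ s.vars ∧ x ∈ t'.vars)) ∧
      ∀ α β : V → Term F V, (∀ x ∈ s.vars, x ∈ t'.vars → α x = β x) →
        u.subst α = v.subst β → t'.subst α = t.subst β := by
  induction h with
  | here t u => exact ⟨v, .here _ _, fun x hx => .inl hx, fun α β _ h => h⟩
  | @app f ts i p u a a' hi _ ih =>
    obtain ⟨b, hb, hvars, hsub⟩ := ih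
    have hlt := (List.getElem?_eq_some_iff.1 hi).1
    have hother : ∀ j c, j ≠ i → ts[j]? = some c → c ∈ ts.set i a' := fun j c hj hc =>
      List.mem_of_getElem? (i := j) (by rw [List.getElem?_set_ne (Ne.symm hj), hc])
    have ha' : a' ∈ ts.set i a' := List.mem_set hlt _
    refine ⟨_, .app hi hb, fun x hx => ?_, fun α β hs huv => ?_⟩
    · obtain ⟨c, hc, hx⟩ := Term.mem_vars_app.1 hx
      obtain ⟨j, hj⟩ := List.mem_iff_getElem?.1 hc
      by_cases hji : j = i
      · subst hji
        rw [List.getElem?_set_self hlt, Option.some.injEq] at hj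
        subst hj
        refine (hvars x hx).imp_right fun ⟨h1, h2⟩ => ⟨?_, ?_⟩
        · exact Term.mem_vars_app.2 ⟨_, List.mem_of_getElem? hi, h1⟩
        · exact Term.mem_vars_app.2 ⟨_, ha', h2⟩
      · rw [List.getElem?_set_ne (Ne.symm hji)] at hj
        exact .inr ⟨Term.mem_vars_app.2 ⟨_, List.mem_of_getElem? hj, hx⟩,
          Term.mem_vars_app.2 ⟨_, hother j c hji hj, hx⟩⟩
    · rw [Term.subst_app, Term.subst_app, Term.app.injEq]
      refine ⟨rfl, List.ext_getElem? fun j => ?_⟩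
      rw [List.getElem?_map, List.getElem?_map]
      by_cases hji : j = i
      · subst hji
        rw [List.getElem?_set_self hlt, List.getElem?_set_self hlt, Option.map_some,
          Option.map_some, hsub α β (fun x h1 h2 => hs x ?_ ?_) huv]
        · exact Term.mem_vars_app.2 ⟨_, List.mem_of_getElem? hi, h1⟩
        · exact Term.mem_vars_app.2 ⟨_, ha', h2⟩
      · rw [List.getElem?_set_ne (Ne.symm hji), List.getElem?_set_ne (Ne.symm hji)]
        cases hc : ts[j]? with
        | none => rfl
        | some c =>
          rw [Option.map_some, Option.map_some, Term.subst_congr fun x hx => hs x ?_ ?_]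
          · exact Term.mem_vars_app.2 ⟨_, List.mem_of_getElem? hc, hx⟩
          · exact Term.mem_vars_app.2 ⟨_, hother j c hji hc, hx⟩

/-- The restriction of a substitution to a set of variables. -/
def restrictSubst (σ : V → Term F V) (S : Set V) (x : V) : Term F V :=
  if x ∈ S then σ x else .var x

lemma restrictSubst_of_mem (σ : V → Term F V) {S : Set V} {x : V} (h : x ∈ S) :
    restrictSubst σ S x = σ x := if_pos h

lemma restrictSubst_of_notMem (σ : V → Term F V) {S : Set V} {x : V} (h : x ∉ S) :
    restrictSubst σ S x = .var x := if_neg h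

namespace NQStepData

variable {M : Model F V D} {ρ : Rule F V} {T T' : NQTerm F V} {p : Pos} {σ : V → Term F V}

lemma notMem_ruleVars (h : NQStepData M ρ T T' p σ) {x : V}
    (hx : x ∈ T.lvars ∨ x ∈ T.term.vars) : x ∉ ρ.vars := fun hρ =>
  h.fresh.le_bot ⟨hρ, .inl hx⟩

lemma vars_apply_subset (h : NQStepData M ρ T T' p σ) {x : V} (hx : x ∈ ρ.lhs.vars) :
    (σ x).vars ⊆ T.term.vars := fun _ hy =>
  h.matchAt.vars_subset (Term.mem_vars_subst.2 ⟨x, hx, hy⟩)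

/-- A valuation `ζ` of the constrained term extends to the rule variables by evaluating `σ`;
on the instantiated rule constraint, restricting `σ` to the left-hand side then makes no
difference. -/
lemma eval_restrict (h : NQStepData M ρ T T' p σ) (ζ e : V → D)
    (he : ∀ x ∈ ρ.constr.vars \ ρ.lhs.vars, e x = M.eval ζ (σ x))
    (he' : ∀ x ∈ (ρ.constr.subst (restrictSubst σ ρ.lhs.vars)).vars, x ∉ ρ.vars → e x = ζ x) :
    M.eval e (ρ.constr.subst (restrictSubst σ ρ.lhs.vars)) = M.eval ζ (ρ.constr.subst σ) := by
  rw [Model.eval_subst, Model.eval_subst]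
  refine M.eval_congr fun x hx => ?_
  by_cases hl : x ∈ ρ.lhs.vars
  · rw [restrictSubst_of_mem σ hl]
    refine M.eval_congr fun y hy => he' y ?_ (h.notMem_ruleVars (.inr (h.vars_apply_subset hl hy)))
    exact Term.mem_vars_subst.2 ⟨x, hx, by rwa [restrictSubst_of_mem σ hl]⟩
  · rw [restrictSubst_of_notMem σ hl, Model.eval_var, he x ⟨hx, hl⟩]

/-- The matching substitution of a step, restricted to the left-hand side, gives a redex of
the existential extension. -/
lemma redexAt_ext (h : NQStepData M ρ T T' p σ) :
    RedexAt M ρ (ext T) p (restrictSubst σ ρ.lhs.vars) where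
  dom := by
    ext x
    have hd : σ x ≠ .var x ↔ x ∈ ρ.vars := by rw [← h.dom]; rfl
    by_cases hx : x ∈ ρ.lhs.vars
    · simpa [substDom, restrictSubst, hx] using hd.2 (.inl (.inl hx))
    · simp [substDom, restrictSubst, hx]
  matchAt := by
    rw [Term.subst_congr fun x hx => restrictSubst_of_mem σ hx]
    exact h.matchAt
  lvar := fun x ⟨hl, hz⟩ => by
    rw [restrictSubst_of_mem σ hl]
    refine (h.zval x hz).imp_right fun ⟨y, hy, hxy⟩ => ⟨y, ⟨hy, fun hb => hb.2 ?_⟩, hxy⟩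
    exact h.vars_apply_subset hl (by rw [hxy]; exact .var)
  implied := fun ξ hξ => by
    obtain ⟨ζ, hζ, hφ⟩ := (EC.holdsUnder_iff _ _ _).1 hξ
    refine (EC.holdsUnder_iff _ _ _).2
      ⟨fun x => if x ∈ ρ.constr.vars \ ρ.lhs.vars then M.eval ζ (σ x) else ξ x,
        fun x hx => if_neg hx, ?_⟩
    refine (h.eval_restrict ζ _ (fun x hx => if_pos hx) fun x hx hxρ => ?_).trans
      (h.implied ζ hφ)
    obtain ⟨z, hz, hxz⟩ := Term.mem_vars_subst.1 hx
    have hl : z ∈ ρ.lhs.vars := by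
      by_contra hl
      rw [restrictSubst_of_notMem σ hl, Term.mem_vars_var] at hxz
      exact hxρ (hxz ▸ .inr hz)
    rw [restrictSubst_of_mem σ hl] at hxz
    rw [if_neg fun hx => hxρ (.inr hx.1)]
    exact (hζ x fun hb => hb.2 (h.vars_apply_subset hl hxz)).symm

end NQStepData

/-- **Simulation of Non-Quantified Rewrite Steps by Existential Extension.** -/
theorem simulation_by_existential_extension {F V D : Type} (M : Model F V D)
    (ρ : Rule F V) (T T' : NQTerm F V)
    (hρ : ρ.WF) (hll : ρ.LeftLinear)
    (hT : T.WF) (hsat : T.satisfiable M)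
    (hstep : NQStep M ρ T T') :
    ∃ U : ECTerm F V, MGStep M ρ (ext T) U ∧ SubsumedBy M (ext T') U := by
  obtain ⟨p, σ, h⟩ := hstep
  set γ := restrictSubst σ ρ.lhs.vars with hγ
  obtain ⟨t, ht, hvars, hsub⟩ := h.target.exchange (ρ.rhs.subst γ)
  set ψ := M.conj T.constr (ρ.constr.subst γ) with hψ
  refine ⟨⟨ρ.exVars ∪ ((ext T).lvars ∩ t.vars), t, ⟨ψ.vars \ t.vars, ψ⟩⟩,
    ⟨p, γ, h.redexAt_ext, ht, rfl, rfl, rfl⟩, fun τ hτ hτc => ?_⟩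
  have hex : ρ.exVars ⊆ ρ.vars := fun x hx => .inl (.inr hx.1)
  have ht_vars : ∀ x ∈ t.vars, x ∈ ρ.exVars ∨ (x ∈ T.term.vars ∧ x ∈ T'.term.vars) := by
    intro x hx
    refine (hvars x hx).elim (fun hx => ?_) .inr
    obtain ⟨w, hw, hxw⟩ := Term.mem_vars_subst.1 hx
    by_cases hl : w ∈ ρ.lhs.vars
    · rw [hγ, restrictSubst_of_mem σ hl] at hxw
      exact .inr ⟨h.vars_apply_subset hl hxw,
        h.target.vars_subset (Term.mem_vars_subst.2 ⟨w, hw, hxw⟩)⟩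
    · rw [hγ, restrictSubst_of_notMem σ hl, Term.mem_vars_var] at hxw
      exact .inl (hxw ▸ ⟨hw, hl⟩)
  have hτ_val : ∀ x ∈ T.lvars, x ∈ T'.term.vars → M.IsValueTerm (τ x) := fun x hx hx' =>
    hτ x ⟨by rw [h.lv]; exact ⟨hx, .inl hx'⟩, fun hb => hb.2 hx'⟩
  have hσ_ex : ∀ x ∈ ρ.exVars,
      M.IsValueTerm (σ x) ∨ ∃ y ∈ T.lvars, y ∈ T'.term.vars ∧ σ x = .var y := fun x hx =>
    (h.zval x (hρ.1 (.inl hx))).imp_right fun ⟨y, hy, hxy⟩ => ⟨y, hy, h.target.vars_subset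
      (Term.mem_vars_subst.2 ⟨x, hx.1, by rw [hxy]; exact .var⟩), hxy⟩
  let δ : V → Term F V := fun x => if x ∈ ρ.exVars then (σ x).subst τ else τ x
  have hδ_ex : ∀ x ∈ ρ.exVars, M.IsValueTerm (δ x) := fun x hx => by
    simp only [δ, if_pos hx]
    rcases hσ_ex x hx with hv | ⟨y, hy, hy', hxy⟩
    · rwa [hv.subst_eq]
    · rw [hxy, Term.subst_var]
      exact hτ_val y hy hy'
  have hδ_of : ∀ x ∉ ρ.vars, δ x = τ x := fun x hx => if_neg fun hx' => hx (hex hx')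
  have hδ_lv : ∀ x ∈ T.lvars, x ∈ t.vars → x ∈ T'.term.vars ∧ δ x = τ x := fun x hx hxt =>
    have hxρ := h.notMem_ruleVars (.inl hx)
    ⟨((ht_vars x hxt).resolve_left fun hx' => hxρ (hex hx')).2, hδ_of x hxρ⟩
  have hδ_val : ∀ x ∈ T.lvars, x ∈ t.vars → M.IsValueTerm (δ x) := fun x hx hxt => by
    obtain ⟨hxt', hxτ⟩ := hδ_lv x hx hxt
    exact hxτ ▸ hτ_val x hx hxt'
  have hψ_vars : ∀ x ∈ ψ.vars, x ∈ T.lvars ∨ x ∈ ρ.constr.vars \ ρ.lhs.vars := by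
    intro x hx
    refine (M.mem_vars_conj.1 hx).elim (fun hx => .inl (hT.1 hx)) fun hx => ?_
    obtain ⟨z, hz, hxz⟩ := Term.mem_vars_subst.1 hx
    by_cases hl : z ∈ ρ.lhs.vars
    · rw [hγ, restrictSubst_of_mem σ hl] at hxz
      rcases h.zval z (hρ.1 (.inr hz)) with hv | ⟨y, hy, hzy⟩
      · exact (hv.not_mem_vars x hxz).elim
      · rw [hzy, Term.mem_vars_var] at hxz
        exact .inl (hxz ▸ hy)
    · rw [hγ, restrictSubst_of_notMem σ hl, Term.mem_vars_var] at hxz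
      exact .inr (hxz ▸ ⟨hz, hl⟩)
  have hex_of : ∀ x ∈ ρ.vars, x ∈ t.vars → x ∈ ρ.exVars := fun x hx hxt =>
    (ht_vars x hxt).resolve_right fun hx' => h.notMem_ruleVars (.inr hx'.1) hx
  have hδ_f : ∀ x ∈ (⟨ψ.vars \ t.vars, ψ⟩ : EC F V).fvars, M.IsValueTerm (δ x) := by
    rintro x ⟨hx, hxb⟩
    have hxt : x ∈ t.vars := by
      by_contra hxt
      exact hxb ⟨hx, hxt⟩
    rcases hψ_vars x hx with hX | hπ
    · exact hδ_val x hX hxt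
    · exact hδ_ex x (hex_of x (.inr hπ.1) hxt)
  refine ⟨δ, ?_, ⟨hδ_f, fun ξ => (EC.holdsUnder_subst_iff _ _ hδ_f _).2 ?_⟩, ?_⟩
  · rintro x (hx | ⟨hx, hxt⟩)
    · exact hδ_ex x hx
    · exact hδ_val x hx.1 hxt
  · obtain ⟨ζ₀, hζ₀, hφ⟩ := (EC.holdsUnder_subst_iff _ _ hτc.1 _).1 (hτc.2 ξ)
    replace hφ : M.holds ζ₀ T.constr := h.cstr ▸ hφ
    replace hζ₀ : ∀ x ∈ T.constr.vars, x ∈ T'.term.vars → ζ₀ x = M.eval ξ (τ x) :=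
      fun x hx hx' => hζ₀ x ⟨by simpa [ext, h.cstr] using hx, fun hb => hb.2 hx'⟩
    let ζ : V → D := fun x => if x ∈ T.constr.vars then ζ₀ x else M.eval ξ (τ x)
    have hζ : ∀ x ∈ T'.term.vars, ζ x = M.eval ξ (τ x) := fun x hx => by
      by_cases hc : x ∈ T.constr.vars
      · simp only [ζ, if_pos hc, hζ₀ x hc hx]
      · simp only [ζ, if_neg hc]
    replace hφ : M.holds ζ T.constr :=
      (M.eval_congr fun x hx => by simp only [ζ, if_pos hx]).trans hφ
    let e : V → D := fun x => if x ∈ ρ.vars then M.eval ζ (σ x) else ζ x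
    refine ⟨e, ?_, (M.holds_conj _ _ _).2 ⟨?_, ?_⟩⟩
    · rintro x ⟨hx, hxb⟩
      have hxt : x ∈ t.vars := by
        by_contra hxt
        exact hxb ⟨hx, hxt⟩
      rcases hψ_vars x hx with hX | hπ
      · obtain ⟨hxt', hxτ⟩ := hδ_lv x hX hxt
        rw [hxτ, ← hζ x hxt']
        exact if_neg (h.notMem_ruleVars (.inl hX))
      · have hxe := hex_of x (.inr hπ.1) hxt
        simp only [e, δ, if_pos hxe, if_pos (hex hxe)]
        rcases hσ_ex x hxe with hv | ⟨y, hy, hy', hxy⟩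
        · rw [hv.subst_eq]
          exact hv.eval_eq _ _
        · rw [hxy, Term.subst_var, Model.eval_var, hζ y hy']
    · refine (M.eval_congr fun x hx => ?_).trans hφ
      exact if_neg (h.notMem_ruleVars (.inl (hT.1 hx)))
    · refine (h.eval_restrict ζ e (fun x hx => if_pos (.inr hx.1))
        fun x _ hx => if_neg hx).trans (h.implied ζ hφ)
  · refine hsub τ δ (fun x hx _ => (hδ_of x (h.notMem_ruleVars (.inr hx))).symm) ?_
    rw [Term.subst_subst, Term.subst_subst]
    refine Term.subst_congr fun x hx => ?_
    by_cases hl : x ∈ ρ.lhs.vars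
    · rw [hγ, restrictSubst_of_mem σ hl]
      exact Term.subst_congr fun y hy =>
        (hδ_of y (h.notMem_ruleVars (.inr (h.vars_apply_subset hl hy)))).symm
    · rw [hγ, restrictSubst_of_notMem σ hl, Term.subst_var]
      exact (if_pos ⟨hx, hl⟩).symm

end

end LCTRS
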